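/- Let S be a subcartesian Poisson space and U an open subset of S. Then the Poisson bracket on C^∞(S) induces a well-defined Poisson bracket on C^∞(U): for h₁, h₂ ∈ C^∞(U) and x ∈ U, set {h₁,h₂}(x) = {f₁,f₂}(x) where f₁, f₂ ∈ C^∞(S) agree with h₁, h₂ on a neighbourhood of x; this is independent of the choice of f₁, f₂ and the resulting bracket is bilinear, antisymmetric, and satisfies the Jacobi identity and the Leibniz rule. -/

import Mathlib

/-- A differential structure in the sense of Sikorski. -/
structure DiffStructure (R : Type*) [TopologicalSpace R] where
  C : Set (R → ℝ)
  subbasis : TopologicalSpace.generateFrom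
      {s : Set R | ∃ f ∈ C, ∃ a b : ℝ, s = f ⁻¹' Set.Ioo a b}
    = (inferInstance : TopologicalSpace R)
  comp : ∀ (n : ℕ) (f : Fin n → R → ℝ), (∀ i, f i ∈ C) →
      ∀ F : (Fin n → ℝ) → ℝ, ContDiff ℝ (⊤ : ℕ∞) F → (fun x => F (fun i => f i x)) ∈ C
  locality : ∀ f : R → ℝ,
      (∀ x : R, ∃ U : Set R, IsOpen U ∧ x ∈ U ∧ ∃ g ∈ C, Set.EqOn f g U) → f ∈ C

/-- The induced differential structure on a subset `A` of `ℝⁿ`. -/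
def CinfSub {n : ℕ} (A : Set (Fin n → ℝ)) : Set (A → ℝ) :=
  {f | ∀ x : A, ∃ U : Set (Fin n → ℝ), IsOpen U ∧ (x : Fin n → ℝ) ∈ U ∧
    ∃ F : (Fin n → ℝ) → ℝ, ContDiff ℝ (⊤ : ℕ∞) F ∧
      ∀ y : A, (y : Fin n → ℝ) ∈ U → f y = F (y : Fin n → ℝ)}

/-- The induced differential structure on a subset `U` of a differential space. -/
def inducedC {R : Type*} [TopologicalSpace R] (D : DiffStructure R) (U : Set R) :
    Set (U → ℝ) :=
  {f | ∀ x : U, ∃ V : Set R, IsOpen V ∧ (x : R) ∈ V ∧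
    ∃ g ∈ D.C, ∀ y : U, (y : R) ∈ V → f y = g (y : R)}

/-- A differential space is subcartesian if every point has an open neighbourhood
diffeomorphic (as a differential space) to a differential subspace of some `ℝⁿ`. -/
def Subcartesian {R : Type*} [TopologicalSpace R] (D : DiffStructure R) : Prop :=
  ∀ x : R, ∃ U : Set R, IsOpen U ∧ x ∈ U ∧ ∃ n : ℕ, ∃ A : Set (Fin n → ℝ),
    ∃ ψ : U → A, ∃ χ : A → U,
      Continuous ψ ∧ Continuous χ ∧ (∀ y, χ (ψ y) = y) ∧ (∀ z, ψ (χ z) = z) ∧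
      (∀ f ∈ CinfSub A, (fun y => f (ψ y)) ∈ inducedC D U) ∧
      (∀ g ∈ inducedC D U, (fun z => g (χ z)) ∈ CinfSub A)

namespace DiffStructure

variable {R : Type*} [TopologicalSpace R] (D : DiffStructure R)

theorem const_mem (c : ℝ) : (fun _ => c) ∈ D.C :=
  D.comp 0 (fun i => i.elim0) (fun i => i.elim0) (fun _ => c) contDiff_const

variable {D}

theorem comp_mem {f : R → ℝ} (hf : f ∈ D.C) {F : ℝ → ℝ} (hF : ContDiff ℝ (⊤ : ℕ∞) F) :
    (fun x => F (f x)) ∈ D.C :=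
  D.comp 1 (fun _ => f) (fun _ => hf) (fun v => F (v 0)) (hF.comp (contDiff_apply ℝ ℝ 0))

theorem add_mem {f g : R → ℝ} (hf : f ∈ D.C) (hg : g ∈ D.C) : f + g ∈ D.C :=
  D.comp 2 ![f, g] (by simp [Fin.forall_fin_two, hf, hg]) (fun v => v 0 + v 1)
    ((contDiff_apply ℝ ℝ 0).add (contDiff_apply ℝ ℝ 1))

theorem mul_mem {f g : R → ℝ} (hf : f ∈ D.C) (hg : g ∈ D.C) : f * g ∈ D.C :=
  D.comp 2 ![f, g] (by simp [Fin.forall_fin_two, hf, hg]) (fun v => v 0 * v 1)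
    ((contDiff_apply ℝ ℝ 0).mul (contDiff_apply ℝ ℝ 1))

theorem smul_mem (a : ℝ) {f : R → ℝ} (hf : f ∈ D.C) : a • f ∈ D.C :=
  mul_mem (D.const_mem a) hf

/-- Bump functions: a point of an open set `W` is separated from the complement of `W` by a
function of the differential structure. -/
theorem exists_ne_zero_support_subset {W : Set R} (hW : IsOpen W) {x : R} (hx : x ∈ W) :
    ∃ b ∈ D.C, b x ≠ 0 ∧ ∀ y ∉ W, b y = 0 := by
  have hD : TopologicalSpace.generateFrom
      {s : Set R | ∃ f ∈ D.C, ∃ a b : ℝ, s = f ⁻¹' Set.Ioo a b} = ‹TopologicalSpace R› := D.subbasis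
  rw [← hD] at hW
  change TopologicalSpace.GenerateOpen _ W at hW
  clear hD
  induction hW with
  | basic s hs =>
    obtain ⟨f, hf, a, b, rfl⟩ := hs
    refine ⟨fun y => expNegInvGlue (f y - a) * expNegInvGlue (b - f y),
      comp_mem hf (F := fun t => expNegInvGlue (t - a) * expNegInvGlue (b - t)) ?_, ?_, ?_⟩
    · exact (expNegInvGlue.contDiff.comp (contDiff_id.sub contDiff_const)).mul
        (expNegInvGlue.contDiff.comp (contDiff_const.sub contDiff_id))
    · exact (mul_pos (expNegInvGlue.pos_of_pos (sub_pos.2 hx.1))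
        (expNegInvGlue.pos_of_pos (sub_pos.2 hx.2))).ne'
    · intro y hy
      rcases le_or_gt (f y) a with h | h
      · simp [expNegInvGlue.zero_of_nonpos (sub_nonpos.2 h)]
      · have h' : b ≤ f y := not_lt.1 fun h' => hy ⟨h, h'⟩
        simp [expNegInvGlue.zero_of_nonpos (sub_nonpos.2 h')]
  | univ => exact ⟨_, D.const_mem 1, one_ne_zero, fun y hy => (hy trivial).elim⟩
  | inter s t _ _ ihs iht =>
    obtain ⟨b, hb, hbx, hb0⟩ := ihs hx.1
    obtain ⟨c, hc, hcx, hc0⟩ := iht hx.2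
    refine ⟨b * c, mul_mem hb hc, mul_ne_zero hbx hcx, fun y hy => ?_⟩
    by_cases hys : y ∈ s
    · simp [hc0 y fun hyt => hy ⟨hys, hyt⟩]
    · simp [hb0 y hys]
  | sUnion T _ ih =>
    obtain ⟨s, hs, hxs⟩ := hx
    obtain ⟨b, hb, hbx, hb0⟩ := ih s hs hxs
    exact ⟨b, hb, hbx, fun y hy => hb0 y fun hys => hy ⟨s, hs, hys⟩⟩

/-- A derivation only depends on the germ of its argument. -/
theorem derivation_congr {X : (R → ℝ) → R → ℝ}
    (hleib : ∀ f ∈ D.C, ∀ g ∈ D.C, X (f * g) = X f * g + X g * f)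
    {W : Set R} (hW : IsOpen W) {x : R} (hx : x ∈ W) {f g : R → ℝ} (hf : f ∈ D.C) (hg : g ∈ D.C)
    (hfg : Set.EqOn f g W) : X f x = X g x := by
  obtain ⟨b, hb, hbx, hb0⟩ := exists_ne_zero_support_subset (D := D) hW hx
  have heq : b * f = b * g := by
    funext y
    by_cases hy : y ∈ W
    · simp [hfg hy]
    · simp [hb0 y hy]
  have h := congrFun (hleib b hb f hf) x
  rw [heq, hleib b hb g hg] at h
  simp only [Pi.add_apply, Pi.mul_apply, hfg hx] at h
  exact (mul_right_cancel₀ hbx (add_left_cancel h)).symm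

/-- The function `f` of the differential structure represents `h : U → ℝ` on the open set `V`. -/
structure Represents (D : DiffStructure R) {U : Set R} (V : Set R) (f : R → ℝ) (h : U → ℝ) :
    Prop where
  isOpen : IsOpen V
  mem : f ∈ D.C
  eq : ∀ y : U, (y : R) ∈ V → h y = f y

namespace Represents

variable {U V W : Set R} {f g : R → ℝ} {h k : U → ℝ}

theorem mono (hf : D.Represents V f h) (hW : IsOpen W) (hWV : W ⊆ V) : D.Represents W f h :=
  ⟨hW, hf.mem, fun y hy => hf.eq y (hWV hy)⟩

theorem add (hf : D.Represents V f h) (hg : D.Represents V g k) :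
    D.Represents V (f + g) (h + k) :=
  ⟨hf.isOpen, add_mem hf.mem hg.mem, fun y hy => by simp [hf.eq y hy, hg.eq y hy]⟩

theorem mul (hf : D.Represents V f h) (hg : D.Represents V g k) :
    D.Represents V (f * g) (h * k) :=
  ⟨hf.isOpen, mul_mem hf.mem hg.mem, fun y hy => by simp [hf.eq y hy, hg.eq y hy]⟩

theorem smul (a : ℝ) (hf : D.Represents V f h) : D.Represents V (a • f) (a • h) :=
  ⟨hf.isOpen, smul_mem a hf.mem, fun y hy => by simp [hf.eq y hy]⟩

end Represents

variable {U : Set R} {h₁ h₂ h₃ : U → ℝ}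

theorem exists_represents (hh : h₁ ∈ inducedC D U) (x : U) :
    ∃ V f, (x : R) ∈ V ∧ D.Represents V f h₁ := by
  obtain ⟨V, hV, hx, f, hf, h⟩ := hh x
  exact ⟨V, f, hx, hV, hf, h⟩

theorem exists_represents₂ (hh₁ : h₁ ∈ inducedC D U) (hh₂ : h₂ ∈ inducedC D U) (x : U) :
    ∃ V f₁ f₂, (x : R) ∈ V ∧ D.Represents V f₁ h₁ ∧ D.Represents V f₂ h₂ := by
  obtain ⟨V, f, hx, hf⟩ := exists_represents hh₁ x
  obtain ⟨W, g, hx', hg⟩ := exists_represents hh₂ x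
  have ho := hf.isOpen.inter hg.isOpen
  exact ⟨V ∩ W, f, g, ⟨hx, hx'⟩, hf.mono ho Set.inter_subset_left,
    hg.mono ho Set.inter_subset_right⟩

theorem exists_represents₃ (hh₁ : h₁ ∈ inducedC D U) (hh₂ : h₂ ∈ inducedC D U)
    (hh₃ : h₃ ∈ inducedC D U) (x : U) :
    ∃ V f₁ f₂ f₃, (x : R) ∈ V ∧ D.Represents V f₁ h₁ ∧ D.Represents V f₂ h₂ ∧
      D.Represents V f₃ h₃ := by
  obtain ⟨V, f₁, f₂, hx, hf₁, hf₂⟩ := exists_represents₂ hh₁ hh₂ x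
  obtain ⟨W, g, hx', hg⟩ := exists_represents hh₃ x
  have ho := hf₁.isOpen.inter hg.isOpen
  exact ⟨V ∩ W, f₁, f₂, g, ⟨hx, hx'⟩, hf₁.mono ho Set.inter_subset_left,
    hf₂.mono ho Set.inter_subset_left, hg.mono ho Set.inter_subset_right⟩

open Classical in
/-- The operation on functions on `U` obtained by applying `br` to local representatives. -/
noncomputable def localBracket (D : DiffStructure R) (br : (R → ℝ) → (R → ℝ) → R → ℝ) (U : Set R)
    (h₁ h₂ : U → ℝ) (x : U) : ℝ :=
  if H : ∃ p : Set R × (R → ℝ) × (R → ℝ),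
      (x : R) ∈ p.1 ∧ D.Represents p.1 p.2.1 h₁ ∧ D.Represents p.1 p.2.2 h₂ then
    br H.choose.2.1 H.choose.2.2 x
  else 0

theorem localBracket_apply {br : (R → ℝ) → (R → ℝ) → R → ℝ} (hU : IsOpen U)
    (hbr : ∀ (W : Set R) (x : R), IsOpen W → x ∈ W → ∀ f₁ ∈ D.C, ∀ f₂ ∈ D.C, ∀ g₁ ∈ D.C,
      ∀ g₂ ∈ D.C, Set.EqOn f₁ g₁ W → Set.EqOn f₂ g₂ W → br f₁ f₂ x = br g₁ g₂ x)
    {V : Set R} {f₁ f₂ : R → ℝ} {x : U} (hx : (x : R) ∈ V)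
    (hf₁ : D.Represents V f₁ h₁) (hf₂ : D.Represents V f₂ h₂) :
    D.localBracket br U h₁ h₂ x = br f₁ f₂ x := by
  have H : ∃ p : Set R × (R → ℝ) × (R → ℝ),
      (x : R) ∈ p.1 ∧ D.Represents p.1 p.2.1 h₁ ∧ D.Represents p.1 p.2.2 h₂ :=
    ⟨(V, f₁, f₂), hx, hf₁, hf₂⟩
  rw [localBracket, dif_pos H]
  obtain ⟨hx', hg₁, hg₂⟩ := H.choose_spec
  refine hbr (U ∩ (V ∩ H.choose.1)) x (hU.inter (hf₁.isOpen.inter hg₁.isOpen)) ⟨x.2, hx, hx'⟩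
    _ hg₁.mem _ hg₂.mem _ hf₁.mem _ hf₂.mem ?_ ?_
  · intro y hy
    rw [← hg₁.eq ⟨y, hy.1⟩ hy.2.2, ← hf₁.eq ⟨y, hy.1⟩ hy.2.1]
  · intro y hy
    rw [← hg₂.eq ⟨y, hy.1⟩ hy.2.2, ← hf₂.eq ⟨y, hy.1⟩ hy.2.1]

end DiffStructure

/-- Lemma 12: On a subcartesian Poisson space `S`, the Poisson
bracket on `C^∞(S)` induces, on every open subset `U`, a well-defined Poisson
bracket on `C^∞(U)`, locally computed from representatives in `C^∞(S)`,
bilinear, antisymmetric, satisfying the Jacobi identity and the Leibniz rule. -/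
theorem stmt_9 {S : Type*} [TopologicalSpace S] [T2Space S] (D : DiffStructure S)
    (hsc : Subcartesian D)
    (br : (S → ℝ) → (S → ℝ) → (S → ℝ))
    (hcl : ∀ f ∈ D.C, ∀ g ∈ D.C, br f g ∈ D.C)
    (hadd : ∀ f₁ ∈ D.C, ∀ f₂ ∈ D.C, ∀ g ∈ D.C, br (f₁ + f₂) g = br f₁ g + br f₂ g)
    (hsmul : ∀ (a : ℝ), ∀ f ∈ D.C, ∀ g ∈ D.C, br (a • f) g = a • br f g)
    (hanti : ∀ f ∈ D.C, ∀ g ∈ D.C, br f g = - br g f)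
    (hjac : ∀ f₁ ∈ D.C, ∀ f₂ ∈ D.C, ∀ f₃ ∈ D.C,
        br f₁ (br f₂ f₃) + br f₂ (br f₃ f₁) + br f₃ (br f₁ f₂) = 0)
    (hleib : ∀ f₁ ∈ D.C, ∀ f₂ ∈ D.C, ∀ f₃ ∈ D.C,
        br f₁ (f₂ * f₃) = br f₁ f₂ * f₃ + br f₁ f₃ * f₂)
    (U : Set S) (hU : IsOpen U) :
    ∃ brU : (↥U → ℝ) → (↥U → ℝ) → (↥U → ℝ),
      -- the bracket takes values in C^∞(U)
      (∀ h₁ ∈ inducedC D U, ∀ h₂ ∈ inducedC D U, brU h₁ h₂ ∈ inducedC D U) ∧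
      -- it is computed from (and is independent of the choice of) local
      -- representatives in C^∞(S)
      (∀ h₁ ∈ inducedC D U, ∀ h₂ ∈ inducedC D U, ∀ x : ↥U,
        ∀ V : Set S, IsOpen V → (x : S) ∈ V →
        ∀ f₁ ∈ D.C, ∀ f₂ ∈ D.C,
          (∀ y : ↥U, (y : S) ∈ V → h₁ y = f₁ (y : S)) →
          (∀ y : ↥U, (y : S) ∈ V → h₂ y = f₂ (y : S)) →
          brU h₁ h₂ x = br f₁ f₂ (x : S)) ∧
      -- bilinearity
      (∀ h₁ ∈ inducedC D U, ∀ h₂ ∈ inducedC D U, ∀ h₃ ∈ inducedC D U,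
        brU (h₁ + h₂) h₃ = brU h₁ h₃ + brU h₂ h₃) ∧
      (∀ (a : ℝ), ∀ h₁ ∈ inducedC D U, ∀ h₂ ∈ inducedC D U,
        brU (a • h₁) h₂ = a • brU h₁ h₂) ∧
      -- antisymmetry
      (∀ h₁ ∈ inducedC D U, ∀ h₂ ∈ inducedC D U, brU h₁ h₂ = - brU h₂ h₁) ∧
      -- Jacobi identity
      (∀ h₁ ∈ inducedC D U, ∀ h₂ ∈ inducedC D U, ∀ h₃ ∈ inducedC D U,
        brU h₁ (brU h₂ h₃) + brU h₂ (brU h₃ h₁) + brU h₃ (brU h₁ h₂) = 0) ∧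
      -- Leibniz rule
      (∀ h₁ ∈ inducedC D U, ∀ h₂ ∈ inducedC D U, ∀ h₃ ∈ inducedC D U,
        brU h₁ (h₂ * h₃) = brU h₁ h₂ * h₃ + brU h₁ h₃ * h₂) := by
  have hright : ∀ (W : Set S) (x : S), IsOpen W → x ∈ W → ∀ f ∈ D.C, ∀ g₁ ∈ D.C, ∀ g₂ ∈ D.C,
      Set.EqOn g₁ g₂ W → br f g₁ x = br f g₂ x := fun W x hW hx f hf g₁ hg₁ g₂ hg₂ h =>
    DiffStructure.derivation_congr (hleib f hf) hW hx hg₁ hg₂ h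
  have hbr : ∀ (W : Set S) (x : S), IsOpen W → x ∈ W → ∀ f₁ ∈ D.C, ∀ f₂ ∈ D.C, ∀ g₁ ∈ D.C,
      ∀ g₂ ∈ D.C, Set.EqOn f₁ g₁ W → Set.EqOn f₂ g₂ W → br f₁ f₂ x = br g₁ g₂ x := by
    intro W x hW hx f₁ hf₁ f₂ hf₂ g₁ hg₁ g₂ hg₂ h₁ h₂
    rw [hright W x hW hx f₁ hf₁ f₂ hf₂ g₂ hg₂ h₂, hanti f₁ hf₁ g₂ hg₂, hanti g₁ hg₁ g₂ hg₂,
      Pi.neg_apply, Pi.neg_apply, hright W x hW hx g₂ hg₂ f₁ hf₁ g₁ hg₁ h₁]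
  have key {V : Set S} {f₁ f₂ : S → ℝ} {h₁ h₂ : U → ℝ} {x : U} (hx : (x : S) ∈ V)
      (hf₁ : D.Represents V f₁ h₁) (hf₂ : D.Represents V f₂ h₂) :
      D.localBracket br U h₁ h₂ x = br f₁ f₂ x :=
    DiffStructure.localBracket_apply hU hbr hx hf₁ hf₂
  have hrep {V : Set S} {f₁ f₂ : S → ℝ} {h₁ h₂ : U → ℝ}
      (hf₁ : D.Represents V f₁ h₁) (hf₂ : D.Represents V f₂ h₂) :
      D.Represents V (br f₁ f₂) (D.localBracket br U h₁ h₂) :=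
    ⟨hf₁.isOpen, hcl _ hf₁.mem _ hf₂.mem, fun _ hy => key hy hf₁ hf₂⟩
  refine ⟨D.localBracket br U, ?_, ?_, ?_, ?_, ?_, ?_, ?_⟩
  · intro h₁ hh₁ h₂ hh₂ x
    obtain ⟨V, f₁, f₂, hx, hf₁, hf₂⟩ := DiffStructure.exists_represents₂ hh₁ hh₂ x
    have h := hrep hf₁ hf₂
    exact ⟨V, h.isOpen, hx, _, h.mem, h.eq⟩
  · intro h₁ _ h₂ _ x V hV hx f₁ hf₁ f₂ hf₂ e₁ e₂
    exact key hx ⟨hV, hf₁, e₁⟩ ⟨hV, hf₂, e₂⟩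
  · intro h₁ hh₁ h₂ hh₂ h₃ hh₃
    funext x
    obtain ⟨V, f₁, f₂, f₃, hx, hf₁, hf₂, hf₃⟩ := DiffStructure.exists_represents₃ hh₁ hh₂ hh₃ x
    rw [Pi.add_apply, key hx (hf₁.add hf₂) hf₃, key hx hf₁ hf₃, key hx hf₂ hf₃,
      hadd f₁ hf₁.mem f₂ hf₂.mem f₃ hf₃.mem, Pi.add_apply]
  · intro a h₁ hh₁ h₂ hh₂
    funext x
    obtain ⟨V, f₁, f₂, hx, hf₁, hf₂⟩ := DiffStructure.exists_represents₂ hh₁ hh₂ x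
    rw [Pi.smul_apply, key hx (hf₁.smul a) hf₂, key hx hf₁ hf₂,
      hsmul a f₁ hf₁.mem f₂ hf₂.mem, Pi.smul_apply]
  · intro h₁ hh₁ h₂ hh₂
    funext x
    obtain ⟨V, f₁, f₂, hx, hf₁, hf₂⟩ := DiffStructure.exists_represents₂ hh₁ hh₂ x
    rw [Pi.neg_apply, key hx hf₁ hf₂, key hx hf₂ hf₁, hanti f₁ hf₁.mem f₂ hf₂.mem, Pi.neg_apply]
  · intro h₁ hh₁ h₂ hh₂ h₃ hh₃
    funext x
    obtain ⟨V, f₁, f₂, f₃, hx, hf₁, hf₂, hf₃⟩ := DiffStructure.exists_represents₃ hh₁ hh₂ hh₃ x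
    rw [Pi.add_apply, Pi.add_apply, key hx hf₁ (hrep hf₂ hf₃), key hx hf₂ (hrep hf₃ hf₁),
      key hx hf₃ (hrep hf₁ hf₂)]
    exact congrFun (hjac f₁ hf₁.mem f₂ hf₂.mem f₃ hf₃.mem) x
  · intro h₁ hh₁ h₂ hh₂ h₃ hh₃
    funext x
    obtain ⟨V, f₁, f₂, f₃, hx, hf₁, hf₂, hf₃⟩ := DiffStructure.exists_represents₃ hh₁ hh₂ hh₃ x
    rw [Pi.add_apply, Pi.mul_apply, Pi.mul_apply, key hx hf₁ (hf₂.mul hf₃), key hx hf₁ hf₂,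
      key hx hf₁ hf₃, hf₂.eq x hx, hf₃.eq x hx, hleib f₁ hf₁.mem f₂ hf₂.mem f₃ hf₃.mem,
      Pi.add_apply, Pi.mul_apply, Pi.mul_apply]
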